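/- arXiv:cs/0701071 — 3 statements merged into one kernel-verified Lean document; each statement's English description precedes it below -/
import Mathlib

section
/- There is a constant c > 0 such that for every integer n ≥ 2, every integer k with 2 ≤ k < n, and every stable wiring s for the uniform (n,k)-BDNF game, the diameter of the wiring satisfies max_{u,v ∈ V} d_s(u,v) ≤ c·√(n·(1 + log n / log k)). -/
namespace BDNF

variable {V : Type} [DecidableEq V]

/-- `connIn s m v u` : there is a directed path with at most `m` edges from `v`
to `u` in the directed graph defined by the wiring `s`. -/
def connIn (s : V → Finset V) : ℕ → V → V → Prop
  | 0, v, u => v = u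
  | m + 1, v, u => v = u ∨ ∃ w ∈ s v, connIn s m w u

/-- Directed hop distance from `v` to `u`, with disconnection penalty `M`. -/
noncomputable def distW (s : V → Finset V) (M : ℕ) (v u : V) : ℕ := by
  classical exact if h : ∃ m, connIn s m v u then Nat.find h else M

/-- Cost of node `v` in the uniform game: the sum of its distances to all
other nodes. -/
noncomputable def cost [Fintype V] (s : V → Finset V) (M : ℕ) (v : V) : ℕ :=
  ∑ u ∈ Finset.univ.filter (fun u => u ≠ v), distW s M v u

/-- `s` is a wiring with out-degree bound `k`: every node links to at most `k`
other nodes. -/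
def IsWiring (k : ℕ) (s : V → Finset V) : Prop :=
  ∀ v, v ∉ s v ∧ (s v).card ≤ k

/-- `s` is stable (a pure Nash equilibrium) for the uniform game: no node can
strictly decrease its cost by rewiring its own out-links. -/
def Stable [Fintype V] (k M : ℕ) (s : V → Finset V) : Prop :=
  ∀ (v : V) (t : Finset V), v ∉ t → t.card ≤ k →
    cost s M v ≤ cost (Function.update s v t) M v

set_option linter.unusedSectionVars false

theorem connIn_refl (s : V → Finset V) (m : ℕ) (v : V) : connIn s m v v := by
  cases m <;> simp [connIn]

theorem connIn_succ {s : V → Finset V} {m : ℕ} {v u : V} (h : connIn s m v u) :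
    connIn s (m + 1) v u := by
  induction m generalizing v with
  | zero => exact Or.inl h
  | succ m ih =>
    rcases h with h | ⟨w, hw, h⟩
    · exact Or.inl h
    · exact Or.inr ⟨w, hw, ih h⟩

theorem connIn_trans {s : V → Finset V} {m m' : ℕ} {v u w : V} (h : connIn s m v u)
    (h' : connIn s m' u w) : connIn s (m + m') v w := by
  induction m generalizing v with
  | zero => obtain rfl : v = u := h; simpa using h'
  | succ m ih =>
    rw [Nat.add_right_comm]
    rcases h with rfl | ⟨x, hx, h⟩
    · exact connIn_succ (ih (connIn_refl s m v))
    · exact Or.inr ⟨x, hx, ih h⟩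

theorem connIn_of_mem {s : V → Finset V} {v u : V} (h : u ∈ s v) : connIn s 1 v u :=
  Or.inr ⟨u, h, rfl⟩

theorem eq_or_exists_connIn_mem {s : V → Finset V} {m : ℕ} {v u : V}
    (h : connIn s (m + 1) v u) : v = u ∨ ∃ w, connIn s m v w ∧ u ∈ s w := by
  induction m generalizing v with
  | zero =>
    rcases h with h | ⟨w, hw, h⟩
    · exact Or.inl h
    · obtain rfl : w = u := h
      exact Or.inr ⟨v, rfl, hw⟩
  | succ m ih =>
    rcases h with h | ⟨w, hw, h⟩
    · exact Or.inl h
    · rcases ih h with rfl | ⟨x, hx, hu⟩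
      · exact Or.inr ⟨v, connIn_refl s _ v, hw⟩
      · exact Or.inr ⟨x, Or.inr ⟨w, hw, hx⟩, hu⟩

/-- `u` can be reached from `v` by a directed path. -/
def Reaches (s : V → Finset V) (v u : V) : Prop :=
  ∃ m, connIn s m v u

theorem Reaches.trans {s : V → Finset V} {v u w : V} (h : Reaches s v u)
    (h' : Reaches s u w) : Reaches s v w :=
  let ⟨_, hm⟩ := h
  let ⟨_, hm'⟩ := h'
  ⟨_, connIn_trans hm hm'⟩

theorem distW_le {s : V → Finset V} {M m : ℕ} {v u : V} (h : connIn s m v u) :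
    distW s M v u ≤ m := by
  classical
  rw [distW, dif_pos ⟨m, h⟩]
  exact Nat.find_min' _ h

theorem Reaches.connIn_distW {s : V → Finset V} {v u : V} (M : ℕ) (h : Reaches s v u) :
    connIn s (distW s M v u) v u := by
  classical
  have h' : ∃ m, connIn s m v u := h
  rw [distW, dif_pos h']
  exact Nat.find_spec h'

theorem distW_of_not_reaches {s : V → Finset V} {v u : V} (M : ℕ) (h : ¬ Reaches s v u) :
    distW s M v u = M := by
  exact dif_neg h

theorem distW_self (s : V → Finset V) (M : ℕ) (v : V) : distW s M v v = 0 :=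
  Nat.le_zero.mp (distW_le (connIn_refl s 0 v))

theorem Reaches.exists_parent {s : V → Finset V} {r u : V} (M : ℕ) (h : Reaches s r u)
    (hne : r ≠ u) : ∃ w, u ∈ s w ∧ Reaches s r w ∧ distW s M r w + 1 = distW s M r u := by
  have hc := h.connIn_distW M
  obtain ⟨m, hm⟩ : ∃ m, distW s M r u = m + 1 := by
    refine Nat.exists_eq_succ_of_ne_zero fun h0 => hne ?_
    rw [h0] at hc
    exact hc
  rw [hm] at hc
  obtain ⟨w, hw, hu⟩ := (eq_or_exists_connIn_mem hc).resolve_left hne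
  refine ⟨w, hu, ⟨m, hw⟩, ?_⟩
  have h1 : distW s M r w ≤ m := distW_le hw
  have h2 : distW s M r u ≤ distW s M r w + 1 :=
    distW_le (connIn_trans (Reaches.connIn_distW M ⟨m, hw⟩) (connIn_of_mem hu))
  omega

/-- A shortest path, given as a sequence of nodes. -/
theorem Reaches.exists_geodesic {s : V → Finset V} {r u : V} (M : ℕ) (h : Reaches s r u) :
    ∃ f : ℕ → V, f (distW s M r u) = u ∧ (∀ j ≤ distW s M r u, distW s M r (f j) = j) ∧
      ∀ j < distW s M r u, f (j + 1) ∈ s (f j) := by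
  induction hd : distW s M r u generalizing u with
  | zero => exact ⟨fun _ => u, rfl, fun j hj => by rw [hd]; omega, fun j hj => by omega⟩
  | succ m ih =>
    have hne : r ≠ u := by
      rintro rfl
      rw [distW_self] at hd
      omega
    obtain ⟨w, hu, hw, hwd⟩ := h.exists_parent M hne
    obtain ⟨f, hf, hfd, hfs⟩ := ih hw (by omega)
    refine ⟨Function.update f (m + 1) u, by simp, fun j hj => ?_, fun j hj => ?_⟩
    · rcases eq_or_ne j (m + 1) with rfl | hj'
      · simpa using hd
      · rw [Function.update_of_ne hj']
        exact hfd j (by omega)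
    · rw [Function.update_of_ne (by omega : j ≠ m + 1)]
      rcases eq_or_ne j m with rfl | hj'
      · rw [hf]
        simpa using hu
      · rw [Function.update_of_ne (by omega)]
        exact hfs j (by omega)

theorem Reaches.distW_lt_card [Fintype V] {s : V → Finset V} {r u : V} (M : ℕ)
    (h : Reaches s r u) : distW s M r u < Fintype.card V := by
  obtain ⟨f, -, hfd, -⟩ := h.exists_geodesic M
  have hinj : Set.InjOn f (Finset.range (distW s M r u + 1)) := by
    intro i hi j hj hij
    have hi' := hfd i (by simp at hi; omega)
    have hj' := hfd j (by simp at hj; omega)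
    rw [hij] at hi'
    omega
  have := Finset.card_image_of_injOn hinj
  rw [Finset.card_range] at this
  exact (this ▸ Finset.card_le_univ _ :)

/-- If `s'` keeps, for every node of a set `Q`, an edge of `s` into it from a node of `Q` that is
one step closer to `r`, then the nodes of `Q` are no farther from `r` in `s'` than in `s`. -/
theorem connIn_distW_of_keep {s s' : V → Finset V} {M : ℕ} {r : V} {Q : V → Prop}
    (hkeep : ∀ u, u ≠ r → Q u → ∃ w, u ∈ s' w ∧ Q w ∧ distW s M r w + 1 = distW s M r u)
    {u : V} (hu : Q u) : connIn s' (distW s M r u) r u := by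
  induction hd : distW s M r u generalizing u with
  | zero =>
    by_contra hne
    obtain ⟨w, -, -, hw⟩ := hkeep u (fun h => hne h.symm) hu
    omega
  | succ m ih =>
    rcases eq_or_ne u r with rfl | hne
    · exact connIn_refl _ _ _
    · obtain ⟨w, huw, hw, hwd⟩ := hkeep u hne hu
      exact connIn_trans (ih hw (by omega)) (connIn_of_mem huw)

/-- Rewiring a node farthest from `r` among those reachable from `r` does not affect the distances
from `r` to the other nodes reachable from `r`. -/
theorem connIn_update_of_farthest {s : V → Finset V} {M : ℕ} {r b : V} (t : Finset V)
    (hmax : ∀ u, Reaches s r u → distW s M r u ≤ distW s M r b) {u : V} (hu : Reaches s r u)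
    (hub : u ≠ b) : connIn (Function.update s b t) (distW s M r u) r u := by
  refine connIn_distW_of_keep (s := s) (Q := fun u => Reaches s r u ∧ u ≠ b) ?_ ⟨hu, hub⟩
  rintro x hxr ⟨hx, -⟩
  obtain ⟨w, hxw, hw, hwd⟩ := hx.exists_parent M hxr.symm
  have hwb : w ≠ b := by
    rintro rfl
    have := hmax x hx
    omega
  exact ⟨w, by rwa [Function.update_of_ne hwb], ⟨hw, hwb⟩, hwd⟩

section Fintype

variable [Fintype V]

theorem cost_eq_sum (s : V → Finset V) (M : ℕ) (v : V) : cost s M v = ∑ u, distW s M v u := by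
  refine Finset.sum_subset (Finset.filter_subset _ _) fun u _ hu => ?_
  obtain rfl : u = v := by simpa using hu
  exact distW_self s M u

theorem cost_le_card_mul_add {s s' : V → Finset V} {M : ℕ} {v v' : V} (c : ℕ)
    (h : ∀ u, u ≠ v' → distW s' M v' u ≤ c + distW s M v u) :
    cost s' M v' ≤ Fintype.card V * c + cost s M v := by
  calc cost s' M v' ≤ ∑ u ∈ Finset.univ.filter (fun u => u ≠ v'), (c + distW s M v u) :=
        Finset.sum_le_sum fun u hu => h u (by simpa using hu)
    _ ≤ ∑ u, (c + distW s M v u) :=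
        Finset.sum_le_sum_of_subset (Finset.filter_subset _ _)
    _ = Fintype.card V * c + cost s M v := by
        rw [Finset.sum_add_distrib, cost_eq_sum]
        simp

theorem distW_le_penalty {s : V → Finset V} {M : ℕ} (hM : Fintype.card V ^ 2 < M) (v u : V) :
    distW s M v u ≤ M := by
  by_cases h : Reaches s v u
  · have := h.distW_lt_card M
    nlinarith
  · rw [distW_of_not_reaches M h]

/-- Stable wirings are strongly connected. -/
theorem Stable.reaches {s : V → Finset V} {k M : ℕ} (hk : 2 ≤ k)
    (hM : Fintype.card V ^ 2 < M) (hs : Stable k M s) (r u : V) : Reaches s r u := by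
  classical
  by_contra hru
  obtain ⟨v, hv, hmax⟩ := (Finset.univ.filter (Reaches s r)).exists_max_image (distW s M r)
    ⟨r, by simpa using ⟨0, connIn_refl s 0 r⟩⟩
  simp only [Finset.mem_filter, Finset.mem_univ, true_and] at hv hmax
  have huv : u ≠ v := fun h => hru (h ▸ hv)
  set t : Finset V := ({r, u} : Finset V).erase v with ht
  have htc : t.card ≤ k := (Finset.card_erase_le.trans Finset.card_le_two).trans hk
  have hst := hs v t (Finset.notMem_erase _ _) htc
  set s' := Function.update s v t with hs'
  have hs'v : s' v = t := Function.update_self _ _ _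
  have hvu : Reaches s' v u := ⟨1, connIn_of_mem (by simp [hs'v, ht, huv])⟩
  have hvr : Reaches s' v r := by
    rcases eq_or_ne r v with rfl | hne
    · exact ⟨0, connIn_refl _ _ _⟩
    · exact ⟨1, connIn_of_mem (by simp [hs'v, ht, hne])⟩
  have hle : ∀ w, w ≠ v → distW s' M v w ≤ Fintype.card V + distW s M v w := by
    intro w hw
    by_cases hrw : Reaches s r w
    · have : Reaches s' v w := hvr.trans ⟨_, connIn_update_of_farthest t hmax hrw hw⟩
      exact (this.distW_lt_card M).le.trans (Nat.le_add_right _ _)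
    · have hvw : ¬ Reaches s v w := fun h => hrw (hv.trans h)
      rw [distW_of_not_reaches M hvw]
      exact (distW_le_penalty hM _ _).trans (Nat.le_add_left _ _)
  have hu : distW s' M v u + M ≤ Fintype.card V + distW s M v u := by
    have hvu' : ¬ Reaches s v u := fun h => hru (hv.trans h)
    rw [distW_of_not_reaches M hvu']
    have := hvu.distW_lt_card M
    omega
  have hmem : u ∈ Finset.univ.filter (fun u => u ≠ v) := by simpa using huv
  have hsum : cost s' M v + M ≤
      ∑ w ∈ Finset.univ.filter (fun u => u ≠ v), (Fintype.card V + distW s M v w) := by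
    rw [cost, ← Finset.add_sum_erase _ _ hmem, ← Finset.add_sum_erase _ _ hmem]
    have := Finset.sum_le_sum (s := (Finset.univ.filter (fun u => u ≠ v)).erase u)
      fun w hw => hle w (by simpa using (Finset.mem_erase.mp hw).2)
    omega
  have hcard : (Finset.univ.filter (fun u => u ≠ v)).card ≤ Fintype.card V :=
    Finset.card_le_univ _
  rw [Finset.sum_add_distrib, Finset.sum_const, smul_eq_mul] at hsum
  change _ ≤ _ + cost s M v at hsum
  nlinarith

/-- The costs of any two nodes of a stable wiring differ by at most `n (1 + log_k n)`. -/
theorem Stable.cost_le {s : V → Finset V} {k M : ℕ} (hk : 2 ≤ k)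
    (hM : Fintype.card V ^ 2 < M) (hwir : IsWiring k s) (hs : Stable k M s) (v r : V) :
    cost s M v ≤ Fintype.card V * (Nat.log k (Fintype.card V) + 1) + cost s M r := by
  classical
  have hreach := hs.reaches hk hM
  choose p hp using fun u : {u // r ≠ u} => (hreach r u).exists_parent M u.2
  let C : V → Finset V := fun x => Finset.univ.filter fun u => ∃ h : r ≠ u, p ⟨u, h⟩ = x
  have hCs : ∀ x, C x ⊆ s x := by
    intro x u hu
    obtain ⟨h, rfl⟩ := (Finset.mem_filter.mp hu).2
    exact (hp ⟨u, h⟩).1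
  obtain ⟨x, hvx, hxC⟩ : ∃ x, connIn s (Nat.log k (Fintype.card V)) v x ∧ (C x).card < k := by
    by_contra! hcon
    have hlevel : ∀ m ≤ Nat.log k (Fintype.card V) + 1,
        ∃ L : Finset V, k ^ m ≤ L.card ∧ ∀ x ∈ L, connIn s m v x := by
      intro m
      induction m with
      | zero => exact fun _ => ⟨{v}, by simp, by simp [connIn]⟩
      | succ m ih =>
        intro hm
        obtain ⟨L, hLc, hL⟩ := ih (by omega)
        refine ⟨L.biUnion C, ?_, ?_⟩
        · rw [Finset.card_biUnion]
          · have hC : ∀ x ∈ L, k ≤ (C x).card := fun x hx => by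
              refine hcon x ?_
              obtain ⟨j, hj⟩ := Nat.exists_eq_add_of_le (Nat.le_of_succ_le_succ hm)
              rw [hj]
              exact connIn_trans (hL x hx) (connIn_refl s j x)
            calc k ^ (m + 1) = k ^ m * k := pow_succ _ _
              _ ≤ L.card * k := Nat.mul_le_mul_right _ hLc
              _ ≤ _ := by simpa using Finset.card_nsmul_le_sum L _ k hC
          · intro x _ y _ hxy
            refine Finset.disjoint_left.mpr fun u hux huy => hxy ?_
            obtain ⟨h, rfl⟩ := (Finset.mem_filter.mp hux).2
            obtain ⟨_, rfl⟩ := (Finset.mem_filter.mp huy).2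
            rfl
        · intro u hu
          obtain ⟨x, hx, hux⟩ := Finset.mem_biUnion.mp hu
          exact connIn_trans (hL x hx) (connIn_of_mem (hCs x hux))
    obtain ⟨L, hLc, -⟩ := hlevel _ le_rfl
    have h1 : L.card ≤ Fintype.card V := Finset.card_le_univ L
    have h2 := Nat.lt_pow_succ_log_self (b := k) (by omega) (Fintype.card V)
    simp only [Nat.succ_eq_add_one] at h2
    omega
  have hx : cost s M x ≤ Fintype.card V * 1 + cost s M r := by
    rcases eq_or_ne r x with rfl | hne
    · exact Nat.le_add_left _ _
    set t := insert r (C x) with ht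
    have hxt : x ∉ t := by
      rw [ht, Finset.mem_insert, not_or]
      exact ⟨hne.symm, fun h => (hwir x).1 (hCs x h)⟩
    refine (hs x t hxt ((Finset.card_insert_le _ _).trans hxC)).trans ?_
    refine cost_le_card_mul_add 1 fun u hu => ?_
    have hru : connIn (Function.update s x t) (distW s M r u) r u := by
      refine connIn_distW_of_keep (s := s) (Q := fun _ => True) (fun y hy _ => ?_) trivial
      refine ⟨p ⟨y, hy.symm⟩, ?_, trivial, (hp ⟨y, hy.symm⟩).2.2⟩
      by_cases hpx : p ⟨y, hy.symm⟩ = x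
      · rw [hpx, Function.update_self]
        exact Finset.mem_insert_of_mem (Finset.mem_filter.mpr ⟨Finset.mem_univ _, hy.symm, hpx⟩)
      · rw [Function.update_of_ne hpx]
        exact (hp ⟨y, hy.symm⟩).1
    exact distW_le (connIn_trans (connIn_of_mem (by simp [ht])) hru)
  have hv : cost s M v ≤ Fintype.card V * Nat.log k (Fintype.card V) + cost s M x :=
    cost_le_card_mul_add _ fun u _ => distW_le (connIn_trans hvx ((hreach x u).connIn_distW M))
  rw [Nat.mul_add]
  omega

/-- If `b` is farthest from `a` in a stable wiring, then `b` is much cheaper than `a`, because `b`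
may link to `a` and to the middle of a shortest path from `a` to `b`. -/
theorem Stable.cost_add_mul_le {s : V → Finset V} {k M : ℕ} (hk : 2 ≤ k)
    (hM : Fintype.card V ^ 2 < M) (hs : Stable k M s) {a b : V}
    (hmax : ∀ u, distW s M a u ≤ distW s M a b) {h : ℕ} (hh : h < distW s M a b) :
    cost s M b + (distW s M a b - h) * h ≤ Fintype.card V + cost s M a := by
  classical
  have hreach := hs.reaches hk hM
  obtain ⟨f, hfb, hfd, hfs⟩ := (hreach a b).exists_geodesic M
  set D := distW s M a b with hD
  have hfne : ∀ j < D, f j ≠ b := by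
    intro j hj hjb
    have := hfd j hj.le
    rw [hjb] at this
    omega
  have hab : a ≠ b := by
    rintro rfl
    rw [distW_self] at hD
    omega
  set t : Finset V := {a, f h} with ht
  have hbt : b ∉ t := by simp [ht, hab.symm, (hfne h hh).symm]
  have hst := hs b t hbt (Finset.card_le_two.trans hk)
  set s' := Function.update s b t with hs'
  have hs'b : s' b = t := Function.update_self _ _ _
  have hdist : ∀ u, u ≠ b → distW s' M b u ≤ 1 + distW s M a u := fun u hu =>
    distW_le (connIn_trans (connIn_of_mem (by simp [hs'b, ht]))
      (connIn_update_of_farthest t (fun u _ => hmax u) (hreach a u) hu))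
  have hpath : ∀ i, h + i < D → connIn s' i (f h) (f (h + i)) := by
    intro i
    induction i with
    | zero => exact fun _ => connIn_refl _ _ _
    | succ i ih =>
      intro hi
      refine connIn_trans (ih (by omega)) (connIn_of_mem ?_)
      rw [hs', Function.update_of_ne (hfne _ (by omega))]
      exact hfs (h + i) (by omega)
  set P := (Finset.Ico h D).image f with hP
  have hPc : P.card = D - h := by
    rw [hP, Finset.card_image_of_injOn, Nat.card_Ico]
    intro i hi j hj hij
    have hi' := hfd i (by simp at hi; omega)
    have hj' := hfd j (by simp at hj; omega)
    rw [hij] at hi'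
    omega
  have hPb : P ⊆ Finset.univ.filter (fun u => u ≠ b) := by
    intro u hu
    obtain ⟨j, hj, rfl⟩ := Finset.mem_image.mp hu
    simpa using hfne j (Finset.mem_Ico.mp hj).2
  have hgain : ∀ u, u ≠ b →
      distW s' M b u + (if u ∈ P then h else 0) ≤ 1 + distW s M a u := by
    intro u hu
    split_ifs with huP
    · obtain ⟨j, hj, rfl⟩ := Finset.mem_image.mp huP
      obtain ⟨hhj, hjD⟩ := Finset.mem_Ico.mp hj
      obtain ⟨i, rfl⟩ := Nat.exists_eq_add_of_le hhj
      have : distW s' M b (f (h + i)) ≤ 1 + i :=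
        distW_le (connIn_trans (connIn_of_mem (by simp [hs'b, ht])) (hpath i hjD))
      rw [hfd _ hjD.le]
      omega
    · exact hdist u hu
  have hsumP : ∑ u ∈ Finset.univ.filter (fun u => u ≠ b), (if u ∈ P then h else 0) =
      (D - h) * h := by
    rw [← Finset.sum_filter, Finset.filter_mem_eq_inter, Finset.inter_eq_right.mpr hPb,
      Finset.sum_const, hPc, smul_eq_mul]
  calc cost s M b + (D - h) * h ≤ cost s' M b + (D - h) * h := by omega
    _ = ∑ u ∈ Finset.univ.filter (fun u => u ≠ b),
          (distW s' M b u + (if u ∈ P then h else 0)) := by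
        rw [Finset.sum_add_distrib, hsumP, cost]
    _ ≤ ∑ u ∈ Finset.univ.filter (fun u => u ≠ b), (1 + distW s M a u) :=
        Finset.sum_le_sum fun u hu => hgain u (by simpa using hu)
    _ ≤ ∑ u, (1 + distW s M a u) := Finset.sum_le_sum_of_subset (Finset.filter_subset _ _)
    _ = Fintype.card V + cost s M a := by
        rw [Finset.sum_add_distrib, cost_eq_sum]
        simp

theorem Stable.sq_distW_le {s : V → Finset V} {k M : ℕ} (hk : 2 ≤ k)
    (hM : Fintype.card V ^ 2 < M) (hwir : IsWiring k s) (hs : Stable k M s) (a v : V) :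
    distW s M a v ^ 2 ≤ 1 + 4 * (Fintype.card V * (Nat.log k (Fintype.card V) + 2)) := by
  obtain ⟨b, -, hb⟩ := Finset.univ.exists_max_image (distW s M a) ⟨a, Finset.mem_univ a⟩
  have hmax : ∀ u, distW s M a u ≤ distW s M a b := fun u => hb u (Finset.mem_univ u)
  refine (Nat.pow_le_pow_left (hmax v) 2).trans ?_
  rcases Nat.eq_zero_or_pos (distW s M a b) with h0 | hpos
  · simp [h0]
  have h1 := hs.cost_add_mul_le hk hM hmax (h := distW s M a b / 2) (by omega)
  have h2 := hs.cost_le hk hM hwir a b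
  have h3 : distW s M a b ^ 2 ≤
      1 + 4 * ((distW s M a b - distW s M a b / 2) * (distW s M a b / 2)) := by
    generalize distW s M a b = D
    rcases Nat.even_or_odd' D with ⟨i, rfl | rfl⟩
    · rw [show 2 * i / 2 = i by omega, show 2 * i - i = i by omega]
      nlinarith
    · rw [show (2 * i + 1) / 2 = i by omega, show 2 * i + 1 - i = i + 1 by omega]
      nlinarith
  rw [Nat.mul_add] at h2 ⊢
  omega

end Fintype

/-- There is a constant `c > 0` such that every stable wiring for a uniform
`(n,k)`-BDNF game with `2 ≤ k < n` has diameter at most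
`c·√(n·(1 + log n / log k))`. -/
theorem stmt_7 :
    ∃ c : ℝ, 0 < c ∧
      ∀ n : ℕ, 2 ≤ n → ∀ k : ℕ, 2 ≤ k → k < n → ∀ M : ℕ, n ^ 2 < M →
        ∀ s : Fin n → Finset (Fin n), IsWiring k s → Stable k M s →
          ∀ u v : Fin n,
            (distW s M u v : ℝ) ≤
              c * Real.sqrt (n * (1 + Real.log n / Real.log k)) := by
  refine ⟨3, by norm_num, fun n hn k hk _ M hM s hwir hs u v => ?_⟩
  have hsq := hs.sq_distW_le hk (by simpa using hM) hwir u v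
  rw [Fintype.card_fin] at hsq
  have hlog : (Nat.log k n : ℝ) ≤ Real.log n / Real.log k := by
    rw [Real.log_div_log]
    exact Real.natLog_le_logb n k
  have hn' : (2 : ℝ) ≤ n := by exact_mod_cast hn
  have hsq' : (distW s M u v : ℝ) ^ 2 ≤ 1 + 4 * (n * (Nat.log k n + 2)) := by
    exact_mod_cast hsq
  have hmul : (n : ℝ) * Nat.log k n ≤ n * (Real.log n / Real.log k) :=
    mul_le_mul_of_nonneg_left hlog (by positivity)
  have hnonneg : (0 : ℝ) ≤ n * Nat.log k n := by positivity
  have h9 : (3 : ℝ) = Real.sqrt (3 ^ 2) := (Real.sqrt_sq (by norm_num)).symm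
  rw [h9, ← Real.sqrt_mul (by norm_num)]
  refine Real.le_sqrt_of_sq_le ?_
  linarith

end BDNF
end

section
/- Let s be a wiring for the uniform (n,k)-BDNF game that is not strongly connected, and let s' be the wiring obtained after node u executes a best-response step. Then for every node v ≠ u, the reach of v in s' either equals the reach of v in s or is at least the reach of u in s'. -/
namespace BDNF

variable {V : Type} [DecidableEq V]

/-- A wiring is strongly connected if every node has a directed path to every
other node. -/
def StronglyConnected (s : V → Finset V) : Prop :=
  ∀ v u : V, ∃ m : ℕ, connIn s m v u

/-- The reach of node `v`: the number of nodes (including `v` itself) to which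
`v` has a directed path. -/
noncomputable def reach (s : V → Finset V) (v : V) : ℕ :=
  Nat.card {u : V // ∃ m : ℕ, connIn s m v u}

/-- `BRStep k M s v s'` : wiring `s'` is obtained from wiring `s` by node `v`
executing a best-response step, i.e. `v` rewires its out-links to a set of at
most `k` other nodes minimizing its resulting cost (keeping its current links
if they are already optimal), while all other nodes keep their links. -/
def BRStep [Fintype V] (k M : ℕ) (s : V → Finset V) (v : V)
    (s' : V → Finset V) : Prop :=
  (∀ u : V, u ≠ v → s' u = s u) ∧ v ∉ s' v ∧ (s' v).card ≤ k ∧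
    (∀ t : Finset V, v ∉ t → t.card ≤ k →
      cost s' M v ≤ cost (Function.update s v t) M v) ∧
    ((∀ t : Finset V, v ∉ t → t.card ≤ k →
      cost s M v ≤ cost (Function.update s v t) M v) → s' v = s v)

theorem exists_connIn_step {s : V → Finset V} {v w x : V} (hw : w ∈ s v)
    (h : ∃ m, connIn s m w x) : ∃ m, connIn s m v x := by
  obtain ⟨m, hm⟩ := h
  exact ⟨m + 1, Or.inr ⟨w, hw, hm⟩⟩

theorem exists_connIn_trans {s : V → Finset V} {v w x : V}
    (hvw : ∃ m, connIn s m v w) (hwx : ∃ m, connIn s m w x) :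
    ∃ m, connIn s m v x := by
  obtain ⟨m, hm⟩ := hvw
  induction m generalizing v with
  | zero =>
    have hv : v = w := hm
    exact hv ▸ hwx
  | succ m ih =>
    rcases hm with rfl | ⟨y, hy, hm⟩
    · exact hwx
    · exact exists_connIn_step hy (ih hm)

/-- Rewiring `u` preserves every path ending in `u`. -/
theorem connIn_self_of_agree {s s' : V → Finset V} {u : V}
    (h : ∀ w, w ≠ u → s' w = s w) {m : ℕ} {v : V} (hm : connIn s m v u) :
    connIn s' m v u := by
  induction m generalizing v with
  | zero => exact hm
  | succ m ih =>
    by_cases hv : v = u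
    · exact Or.inl hv
    · rcases hm with hm | ⟨w, hw, hm⟩
      · exact Or.inl hm
      · exact Or.inr ⟨w, (h v hv).symm ▸ hw, ih hm⟩

/-- Rewiring `u` preserves every path starting at a node that does not reach `u`. -/
theorem connIn_of_agree {s s' : V → Finset V} {u : V}
    (h : ∀ w, w ≠ u → s' w = s w) {m : ℕ} {v x : V}
    (hvu : ¬ ∃ m, connIn s m v u) (hm : connIn s m v x) : connIn s' m v x := by
  induction m generalizing v with
  | zero => exact hm
  | succ m ih =>
    have hv : v ≠ u := by
      rintro rfl
      exact hvu ⟨0, connIn_refl s 0 v⟩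
    rcases hm with hm | ⟨w, hw, hm⟩
    · exact Or.inl hm
    · exact Or.inr ⟨w, (h v hv).symm ▸ hw,
        ih (fun hwu => hvu (exists_connIn_step hw hwu)) hm⟩

theorem reach_le_of_connIn [Finite V] {s : V → Finset V} {v u : V}
    (h : ∃ m, connIn s m v u) : reach s u ≤ reach s v :=
  Nat.card_mono (Set.toFinite {x | ∃ m, connIn s m v x})
    (fun _ hx => exists_connIn_trans h hx)

theorem reach_eq_of_agree {s s' : V → Finset V} {u v : V}
    (h : ∀ w, w ≠ u → s' w = s w) (hvu : ¬ ∃ m, connIn s m v u) :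
    reach s' v = reach s v := by
  have h' : ∀ w, w ≠ u → s w = s' w := fun w hw => (h w hw).symm
  have hvu' : ¬ ∃ m, connIn s' m v u := fun ⟨m, hm⟩ =>
    hvu ⟨m, connIn_self_of_agree h' hm⟩
  exact Nat.card_congr (Equiv.subtypeEquivRight fun x =>
    ⟨fun ⟨m, hm⟩ => ⟨m, connIn_of_agree h' hvu' hm⟩,
      fun ⟨m, hm⟩ => ⟨m, connIn_of_agree h hvu hm⟩⟩)

/-- If a wiring `s` is not strongly connected and `s'` is obtained from `s` by
node `u` executing a best-response step, then for every node `v ≠ u`, the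
reach of `v` in `s'` either equals the reach of `v` in `s` or is at least the
(new) reach of `u` in `s'`. -/
theorem stmt_10 :
    ∀ n : ℕ, 2 ≤ n → ∀ k : ℕ, 1 ≤ k → k < n → ∀ M : ℕ, n ^ 2 < M →
      ∀ s s' : Fin n → Finset (Fin n), IsWiring k s →
        ¬ StronglyConnected s →
        ∀ u : Fin n, BRStep k M s u s' →
          ∀ v : Fin n, v ≠ u →
            reach s' v = reach s v ∨ reach s' u ≤ reach s' v := by
  intro n _ k _ _ M _ s s' _ _ u hbr v _
  by_cases hvu : ∃ m, connIn s m v u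
  · obtain ⟨m, hm⟩ := hvu
    exact Or.inr (reach_le_of_connIn ⟨m, connIn_self_of_agree hbr.1 hm⟩)
  · exact Or.inl (reach_eq_of_agree hbr.1 hvu)

end BDNF
end

section
/- There is a constant c > 0 such that for infinitely many integers n there exist an initial wiring for the uniform (n,1)-BDNF game and a round-robin best-response walk (a sequence of rounds, each consisting of n best-response steps in which each node acts exactly once) such that the wiring is still not strongly connected after c·n² best-response steps. -/
namespace BDNF

variable {V : Type} [DecidableEq V]

section FunctionalGraph

theorem connIn_singleton_iff {W : Type} {s : W → Finset W} {f : W → W} (hs : ∀ x, s x = {f x}) (m : ℕ)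
    (v u : W) : connIn s m v u ↔ ∃ i ≤ m, f^[i] v = u := by
  induction m generalizing v with
  | zero => simp [connIn]
  | succ m ih =>
    simp only [connIn, hs, Finset.mem_singleton, exists_eq_left, ih]
    constructor
    · rintro (h | ⟨i, hi, h⟩)
      · exact ⟨0, by omega, h⟩
      · exact ⟨i + 1, by omega, by simpa using h⟩
    · rintro ⟨i, hi, h⟩
      cases i with
      | zero => exact Or.inl h
      | succ i => exact Or.inr ⟨i, by omega, by simpa using h⟩

theorem distW_of_not_reachable {W : Type} {s : W → Finset W} {M : ℕ} {v u : W}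
    (h : ¬ ∃ m, connIn s m v u) : distW s M v u = M := by
  simp only [distW, dif_neg h]

theorem distW_of_minimal {W : Type} {s : W → Finset W} {M m : ℕ} {v u : W} (h : connIn s m v u)
    (hmin : ∀ l < m, ¬ connIn s l v u) : distW s M v u = m := by
  classical
  have h' : ∃ m, connIn s m v u := ⟨m, h⟩
  simp only [distW, dif_pos h']
  exact (Nat.find_eq_iff h').2 ⟨h, hmin⟩

/-- The cost of a node that reaches exactly `r` others, one at each distance `1, …, r`. -/
def reachCost (n M r : ℕ) : ℕ := ∑ i ∈ Finset.range r, (i + 1) + (n - 1 - r) * M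

theorem reachCost_succ_lt {n M r : ℕ} (hM : n < M) (hr : r + 1 < n) :
    reachCost n M (r + 1) < reachCost n M r := by
  obtain ⟨d, rfl⟩ : ∃ d, n = d + r + 2 := ⟨n - r - 2, by omega⟩
  have h₁ : d + r + 2 - 1 - (r + 1) = d := by omega
  have h₂ : d + r + 2 - 1 - r = d + 1 := by omega
  simp only [reachCost, Finset.sum_range_succ, h₁, h₂, Nat.succ_mul]
  omega

theorem reachCost_anti {n M a b : ℕ} (hM : n < M) (hab : a ≤ b) (hb : b < n) :
    reachCost n M b ≤ reachCost n M a := by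
  induction b, hab using Nat.le_induction with
  | base => rfl
  | succ b _ ih => exact (reachCost_succ_lt hM hb).le.trans (ih (by omega))

/-- The forward orbit of `v` is listed without repetition by its first `K` iterates. -/
theorem exists_orbit_enumeration [Fintype V] (f : V → V) (v : V) :
    ∃ K, 0 < K ∧ Set.InjOn (fun i => f^[i] v) (Finset.range K) ∧
      ∀ i, ∃ l < K, f^[l] v = f^[i] v := by
  classical
  have hex : ∃ K, ∃ l < K, f^[l] v = f^[K] v := by
    obtain ⟨a, b, hab, h⟩ := Finite.exists_ne_map_eq_of_infinite (fun i : ℕ => f^[i] v)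
    rcases lt_or_gt_of_ne hab with hlt | hlt
    · exact ⟨b, a, hlt, h⟩
    · exact ⟨a, b, hlt, h.symm⟩
  obtain ⟨l₀, hl₀, h₀⟩ := Nat.find_spec hex
  refine ⟨Nat.find hex, by omega, ?_, ?_⟩
  · intro a ha b hb hab
    simp only [Finset.coe_range, Set.mem_Iio] at ha hb
    by_contra hne
    rcases lt_or_gt_of_ne hne with hlt | hlt
    · exact Nat.find_min hex hb ⟨a, hlt, hab⟩
    · exact Nat.find_min hex ha ⟨b, hlt, hab.symm⟩
  · intro i
    induction i with
    | zero => exact ⟨0, by omega, rfl⟩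
    | succ i ih =>
      obtain ⟨l, hl, h⟩ := ih
      have hs : f^[l + 1] v = f^[i + 1] v := by
        rw [Function.iterate_succ_apply', Function.iterate_succ_apply', h]
      rcases Nat.lt_or_ge (l + 1) (Nat.find hex) with hlt | hge
      · exact ⟨l + 1, hlt, hs⟩
      · have : l + 1 = Nat.find hex := by omega
        exact ⟨l₀, hl₀, by rw [← hs, this, h₀]⟩

theorem exists_cost_eq_reachCost [Fintype V] {s : V → Finset V} {f : V → V}
    (hs : ∀ x, s x = {f x}) (M : ℕ) (v : V) :
    ∃ O : Finset V, (∀ u, u ∈ O ↔ ∃ i, f^[i] v = u) ∧ 0 < O.card ∧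
      cost s M v = reachCost (Fintype.card V) M (O.card - 1) := by
  classical
  obtain ⟨K, hK, hinj, hall⟩ := exists_orbit_enumeration f v
  have hmem : ∀ u, u ∈ (Finset.range K).image (fun i => f^[i] v) ↔ ∃ i, f^[i] v = u := by
    intro u
    simp only [Finset.mem_image, Finset.mem_range]
    constructor
    · rintro ⟨i, -, h⟩
      exact ⟨i, h⟩
    · rintro ⟨i, rfl⟩
      exact hall i
  have hcard : ((Finset.range K).image (fun i => f^[i] v)).card = K := by
    rw [Finset.card_image_of_injOn hinj, Finset.card_range]
  refine ⟨(Finset.range K).image (fun i => f^[i] v), hmem, by omega, ?_⟩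
  have hdist : ∀ i < K, distW s M v (f^[i] v) = i := by
    intro i hi
    refine distW_of_minimal ((connIn_singleton_iff hs _ _ _).2 ⟨i, le_rfl, rfl⟩) ?_
    intro l hl hc
    obtain ⟨a, ha, h⟩ := (connIn_singleton_iff hs _ _ _).1 hc
    have := hinj (by simp; omega) (by simpa using hi) h
    omega
  have hfar : ∀ u, u ∉ (Finset.range K).image (fun i => f^[i] v) → distW s M v u = M := by
    intro u hu
    refine distW_of_not_reachable ?_
    rintro ⟨m, hm⟩
    obtain ⟨i, -, h⟩ := (connIn_singleton_iff hs _ _ _).1 hm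
    exact hu ((hmem u).2 ⟨i, h⟩)
  have hself : distW s M v v = 0 := hdist 0 hK
  have hcost : cost s M v = ∑ u, distW s M v u := by
    rw [cost, Finset.sum_filter_of_ne]
    rintro u - hu rfl
    exact hu hself
  rw [hcost, ← Finset.sum_add_sum_compl ((Finset.range K).image (fun i => f^[i] v)),
    Finset.sum_image hinj,
    Finset.sum_congr rfl (fun i hi => hdist i (Finset.mem_range.1 hi)),
    Finset.sum_congr rfl (fun u hu => hfar u (Finset.mem_compl.1 hu)),
    Finset.sum_const, Finset.card_compl, hcard, reachCost]
  obtain ⟨k, rfl⟩ : ∃ k, K = k + 1 := ⟨K - 1, by omega⟩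
  rw [Finset.sum_range_succ', Nat.add_sub_cancel, Nat.sub_sub, Nat.add_comm 1 k]
  simp

theorem reachCost_le_cost [Fintype V] {s : V → Finset V} {f : V → V} (hs : ∀ x, s x = {f x})
    {M r : ℕ} (hM : Fintype.card V < M) (hr : r < Fintype.card V) {v : V} {S : Finset V}
    (hv : v ∈ S) (hS : ∀ x ∈ S, f x ∈ S) (hcard : S.card ≤ r + 1) :
    reachCost (Fintype.card V) M r ≤ cost s M v := by
  obtain ⟨O, hO, hpos, hc⟩ := exists_cost_eq_reachCost hs M v
  have hsub : O ⊆ S := by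
    intro u hu
    obtain ⟨i, rfl⟩ := (hO u).1 hu
    clear hu
    induction i with
    | zero => exact hv
    | succ i ih =>
      rw [Function.iterate_succ_apply']
      exact hS _ ih
  have := Finset.card_le_card hsub
  rw [hc]
  exact reachCost_anti hM (by omega) hr

theorem cost_le_reachCost [Fintype V] {s : V → Finset V} {f : V → V} (hs : ∀ x, s x = {f x})
    {M r : ℕ} (hM : Fintype.card V < M) {v : V} {S : Finset V}
    (hS : ∀ x ∈ S, ∃ i, f^[i] v = x) (hcard : r + 1 ≤ S.card) :
    cost s M v ≤ reachCost (Fintype.card V) M r := by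
  obtain ⟨O, hO, hpos, hc⟩ := exists_cost_eq_reachCost hs M v
  have := Finset.card_le_card (fun u hu => (hO u).2 (hS u hu) : S ⊆ O)
  have := Finset.card_le_univ O
  rw [hc]
  exact reachCost_anti hM (by omega) (by omega)

theorem cost_of_eq_empty [Fintype V] {s : V → Finset V} {v : V} (hs : s v = ∅) (M : ℕ) :
    cost s M v = reachCost (Fintype.card V) M 0 := by
  have h : ∀ u ∈ Finset.univ.filter (fun u => u ≠ v), distW s M v u = M := by
    intro u hu
    refine distW_of_not_reachable ?_
    rintro ⟨m, hm⟩
    have hne : v ≠ u := (Finset.mem_filter.1 hu).2.symm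
    cases m <;> simp [connIn, hs, hne] at hm
  rw [cost, Finset.sum_congr rfl h, Finset.sum_const, Finset.filter_ne',
    Finset.card_erase_of_mem (Finset.mem_univ v), Finset.card_univ]
  simp [reachCost]

end FunctionalGraph

section Lasso

variable {n : ℕ}

/-- The successor on positions `0, …, n - 1` of a lasso with tail `0, …, t - 1`. -/
def lassoNext (t : ℕ) (j : Fin n) : Fin n :=
  ⟨if (j : ℕ) + 1 < n then j + 1 else min t j, by split <;> omega⟩

/-- The lasso on `Fin n` visiting the nodes in the order `σ`. -/
def lassoMap (σ : Equiv.Perm (Fin n)) (t : ℕ) (x : Fin n) : Fin n :=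
  σ (lassoNext t (σ.symm x))

/-- The wiring of the lasso visiting the nodes in the order `σ`, with a tail of size `t`. -/
def lasso (σ : Equiv.Perm (Fin n)) (t : ℕ) (x : Fin n) : Finset (Fin n) :=
  {lassoMap σ t x}

theorem lassoNext_val (t : ℕ) (j : Fin n) :
    (lassoNext t j : ℕ) = if (j : ℕ) + 1 < n then (j : ℕ) + 1 else min t j := rfl

theorem lassoNext_ne {t : ℕ} (ht : t + 2 ≤ n) (j : Fin n) : lassoNext t j ≠ j := by
  intro h
  have := congrArg Fin.val h
  simp only [lassoNext] at this
  split at this <;> omega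

theorem isWiring_lasso (σ : Equiv.Perm (Fin n)) {t : ℕ} (ht : t + 2 ≤ n) :
    IsWiring 1 (lasso σ t) := by
  intro v
  refine ⟨?_, by simp [lasso]⟩
  simp only [lasso, lassoMap, Finset.mem_singleton]
  intro h
  exact lassoNext_ne ht (σ.symm v) (by rw [Equiv.eq_symm_apply, ← h])

theorem lassoMap_iterate (σ : Equiv.Perm (Fin n)) (t i : ℕ) (j : Fin n) :
    (lassoMap σ t)^[i] (σ j) = σ ((lassoNext t)^[i] j) := by
  induction i with
  | zero => rfl
  | succ i ih =>
    rw [Function.iterate_succ_apply', Function.iterate_succ_apply', ih]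
    simp [lassoMap]

theorem lassoNext_iterate_val (t i : ℕ) (j : Fin n) (h : (j : ℕ) + i < n) :
    (((lassoNext t)^[i] j : Fin n) : ℕ) = j + i := by
  induction i with
  | zero => rfl
  | succ i ih =>
    have := ih (by omega)
    rw [Function.iterate_succ_apply', lassoNext]
    simp only [this]
    rw [if_pos (by omega)]
    omega

theorem exists_lassoNext_iterate {t : ℕ} (ht : t < n) {j k : Fin n} (h : min (j : ℕ) t ≤ k) :
    ∃ i, (lassoNext t)^[i] j = k := by
  rcases Nat.lt_or_ge k j with hlt | hge
  · refine ⟨(k - t) + (1 + (n - 1 - j)), ?_⟩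
    have hlast := lassoNext_iterate_val t (n - 1 - j) j (by omega)
    rw [Function.iterate_add_apply, Function.iterate_add_apply]
    have hback : (((lassoNext t)^[1] ((lassoNext t)^[n - 1 - j] j) : Fin n) : ℕ) = t := by
      simp only [Function.iterate_one, lassoNext, hlast]
      rw [if_neg (by omega)]
      omega
    apply Fin.ext
    rw [lassoNext_iterate_val _ _ _ (by omega), hback]
    omega
  · exact ⟨k - j, Fin.ext (by rw [lassoNext_iterate_val _ _ _ (by omega)]; omega)⟩

theorem card_map_filter_val (σ : Equiv.Perm (Fin n)) (a b : ℕ) (hb : b ≤ n) :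
    ((Finset.univ.filter (fun j : Fin n => a ≤ j ∧ (j : ℕ) < b)).map σ.toEmbedding).card
      = b - a := by
  rw [Finset.card_map, ← Finset.card_map Fin.valEmbedding, ← Nat.card_Ico]
  congr 1
  ext x
  simp only [Finset.mem_map, Finset.mem_filter, Finset.mem_univ, true_and, Fin.valEmbedding_apply,
    Finset.mem_Ico]
  constructor
  · rintro ⟨j, h, rfl⟩
    exact h
  · intro h
    exact ⟨⟨x, by omega⟩, h, rfl⟩

theorem cost_lasso_le (σ : Equiv.Perm (Fin n)) {t M : ℕ} (ht : t < n) (hM : n < M) (j : Fin n) :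
    cost (lasso σ t) M (σ j) ≤ reachCost n M (n - 1 - min (j : ℕ) t) := by
  have h := cost_le_reachCost (s := lasso σ t) (f := lassoMap σ t) (fun _ => rfl) (M := M)
    (r := n - 1 - min (j : ℕ) t) (v := σ j) (by simpa using hM)
    (S := (Finset.univ.filter (fun k : Fin n => min (j : ℕ) t ≤ k ∧ (k : ℕ) < n)).map
      σ.toEmbedding) ?_ ?_
  · simpa using h
  · simp only [Finset.mem_map, Finset.mem_filter, Finset.mem_univ, true_and]
    rintro _ ⟨k, hk, rfl⟩
    obtain ⟨i, hi⟩ := exists_lassoNext_iterate ht hk.1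
    exact ⟨i, by rw [lassoMap_iterate, hi]; rfl⟩
  · rw [card_map_filter_val _ _ _ le_rfl]
    omega

theorem reachCost_le_cost_update_of_closed (σ : Equiv.Perm (Fin n)) {t M : ℕ} (hM : n < M)
    (i j : Fin n) {a b r : ℕ} (hb : b ≤ n) (hr : r < n) (hab : b ≤ a + r + 1)
    (hj : a ≤ j ∧ (j : ℕ) < b) (hi : a ≤ i ∧ (i : ℕ) < b)
    (hclosed : ∀ k : Fin n, k ≠ j → a ≤ k → (k : ℕ) < b →
      a ≤ (lassoNext t k : ℕ) ∧ (lassoNext t k : ℕ) < b) :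
    reachCost n M r ≤ cost (Function.update (lasso σ t) (σ j) {σ i}) M (σ j) := by
  have h := reachCost_le_cost (s := Function.update (lasso σ t) (σ j) {σ i})
    (f := Function.update (lassoMap σ t) (σ j) (σ i)) (M := M) (r := r) (v := σ j)
    (S := (Finset.univ.filter (fun k : Fin n => a ≤ k ∧ (k : ℕ) < b)).map σ.toEmbedding)
    ?_ (by simpa using hM) (by simpa using hr) ?_ ?_ ?_
  · simpa using h
  · intro x
    by_cases hx : x = σ j
    · subst hx; simp
    · simp [hx, lasso]
  · simpa using hj
  · simp only [Finset.mem_map, Finset.mem_filter, Finset.mem_univ, true_and]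
    rintro _ ⟨k, hk, rfl⟩
    by_cases hkj : k = j
    · subst hkj
      exact ⟨i, hi, by simp⟩
    · exact ⟨lassoNext t k, hclosed k hkj hk.1 hk.2, by simp [hkj, lassoMap]⟩
  · rw [card_map_filter_val _ _ _ hb]
    omega

theorem reachCost_le_cost_update (σ : Equiv.Perm (Fin n)) {t M : ℕ} (ht : t < n) (hM : n < M)
    (j : Fin n) {T : Finset (Fin n)} (hT : T.card ≤ 1) :
    reachCost n M (max (n - 1 - min (j : ℕ) t) j) ≤
      cost (Function.update (lasso σ t) (σ j) T) M (σ j) := by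
  have hr : max (n - 1 - min (j : ℕ) t) j < n := by omega
  have : Nonempty (Fin n) := ⟨j⟩
  obtain ⟨x, hx⟩ := Finset.card_le_one_iff_subset_singleton.1 hT
  rcases Finset.subset_singleton_iff.1 hx with rfl | rfl
  · rw [cost_of_eq_empty (by simp), Fintype.card_fin]
    exact reachCost_anti hM (Nat.zero_le _) hr
  · obtain ⟨i, rfl⟩ := σ.surjective x
    by_cases hback : min (j : ℕ) t ≤ i
    · refine reachCost_le_cost_update_of_closed σ hM i j (a := min (j : ℕ) t) le_rfl hr (by omega)
        (by omega) (by omega) fun k hkj hk _ => ?_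
      rw [lassoNext_val]
      split <;> omega
    · refine reachCost_le_cost_update_of_closed σ hM i j (a := 0) (b := j + 1) (by omega) hr
        (by omega) (by omega) (by omega) fun k hkj _ hk => ?_
      have : (k : ℕ) ≠ j := fun h => hkj (Fin.ext h)
      rw [lassoNext_val]
      split <;> omega

theorem brStep_lasso_self (σ : Equiv.Perm (Fin n)) {t M : ℕ} (ht : 2 * t ≤ n) (hn : 3 ≤ n)
    (hM : n < M) (j : Fin n) (hj : (j : ℕ) + t < n) :
    BRStep 1 M (lasso σ t) (σ j) (lasso σ t) := by
  have hw := isWiring_lasso σ (t := t) (by omega)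
  refine ⟨fun _ _ => rfl, (hw _).1, (hw _).2, fun T _ hT => ?_, fun _ => rfl⟩
  refine (cost_lasso_le σ (by omega) hM j).trans ?_
  have := reachCost_le_cost_update σ (by omega : t < n) hM j hT
  rwa [max_eq_left (by omega)] at this

/-- The position, in a lasso with tail size `t`, of the `j`-th node of the lasso obtained from it
when the node at position `n - t` links to the start of the tail. -/
def reorderMap (t : ℕ) (j : Fin n) : Fin n :=
  if h : (j : ℕ) + 1 < t ∧ 2 * t ≤ n then ⟨j + (n - t) + 1, by omega⟩
  else if h : (j : ℕ) < n - t ∧ 0 < t then ⟨j + 1, by omega⟩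
  else ⟨j - (n - t), by omega⟩

theorem reorderMap_injective {t : ℕ} (h₀ : 0 < t) (ht : 2 * t ≤ n) :
    Function.Injective (reorderMap t : Fin n → Fin n) := by
  intro a b h
  have := congrArg Fin.val h
  apply Fin.ext
  simp only [reorderMap] at this
  split_ifs at this <;> simp only at this <;> omega

theorem reorderMap_val {t : ℕ} (h₀ : 0 < t) (ht : 2 * t ≤ n) (j : Fin n) :
    (reorderMap t j : ℕ) = if (j : ℕ) + 1 < t then (j : ℕ) + (n - t) + 1
      else if (j : ℕ) < n - t then (j : ℕ) + 1 else j - (n - t) := by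
  simp only [reorderMap]
  split_ifs <;> simp only <;> omega

theorem reorderMap_lassoNext_val {t : ℕ} (h₀ : 0 < t) (ht : 2 * t ≤ n) (k : Fin n) :
    (reorderMap t (lassoNext (t - 1) k) : ℕ) =
      if (reorderMap t k : ℕ) = n - t then 0 else (lassoNext t (reorderMap t k) : ℕ) := by
  have h₁ := reorderMap_val h₀ ht k
  have h₂ := lassoNext_val (t - 1) k
  have h₃ := reorderMap_val h₀ ht (lassoNext (t - 1) k)
  have h₄ := lassoNext_val t (reorderMap t k)
  have hk := k.2
  generalize (reorderMap t (lassoNext (t - 1) k) : ℕ) = w at *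
  generalize (lassoNext t (reorderMap t k) : ℕ) = x at *
  generalize (lassoNext (t - 1) k : ℕ) = y at *
  generalize (reorderMap t k : ℕ) = z at *
  split_ifs at * <;> omega

/-- `reorderMap` as a permutation, for tail sizes between `1` and `n / 2`. -/
noncomputable def reorder (n t : ℕ) : Equiv.Perm (Fin n) :=
  if h : 0 < t ∧ 2 * t ≤ n then
    Equiv.ofBijective (reorderMap t) (Finite.injective_iff_bijective.1 (reorderMap_injective h.1 h.2))
  else 1

theorem reorder_apply {t : ℕ} (h₀ : 0 < t) (ht : 2 * t ≤ n) (j : Fin n) :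
    reorder n t j = reorderMap t j := by
  rw [reorder, dif_pos ⟨h₀, ht⟩]
  rfl

theorem lasso_reorder (σ : Equiv.Perm (Fin n)) {t : ℕ} (h₀ : 0 < t) (ht : 2 * t ≤ n)
    (c z : Fin n) (hc : (c : ℕ) = n - t) (hz : (z : ℕ) = 0) :
    lasso ((reorder n t).trans σ) (t - 1) = Function.update (lasso σ t) (σ c) {σ z} := by
  funext x
  obtain ⟨k, rfl⟩ := ((reorder n t).trans σ).surjective x
  simp only [lasso, lassoMap, Equiv.symm_apply_apply]
  simp only [Equiv.trans_apply, reorder_apply h₀ ht]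
  have hval := reorderMap_lassoNext_val h₀ ht k
  by_cases hk : reorderMap t k = c
  · rw [hk, if_pos hc] at hval
    rw [hk, Function.update_self]
    congr 2
    exact Fin.ext (hval.trans hz.symm)
  · rw [if_neg fun h => hk (Fin.ext (h.trans hc.symm))] at hval
    rw [Function.update_of_ne (by simpa using hk)]
    simp only [lasso, lassoMap, Equiv.symm_apply_apply]
    congr 2
    exact Fin.ext hval

theorem brStep_lasso_reorder (σ : Equiv.Perm (Fin n)) {t M : ℕ} (h₀ : 0 < t) (ht : 2 * t ≤ n)
    (hn : 3 ≤ n) (hM : n < M) (c : Fin n) (hc : (c : ℕ) = n - t) :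
    BRStep 1 M (lasso σ t) (σ c) (lasso ((reorder n t).trans σ) (t - 1)) := by
  have hupd := lasso_reorder σ h₀ ht c ⟨0, by omega⟩ hc rfl
  have hw := isWiring_lasso ((reorder n t).trans σ) (t := t - 1) (by omega)
  have hpos : σ c = ((reorder n t).trans σ) ⟨n - t - 1, by omega⟩ := by
    rw [Equiv.trans_apply, reorder_apply h₀ ht]
    congr 1
    apply Fin.ext
    rw [reorderMap_val h₀ ht]
    split_ifs <;> simp only at * <;> omega
  have hcost : cost (lasso ((reorder n t).trans σ) (t - 1)) M (σ c) ≤ reachCost n M c := by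
    have := cost_lasso_le ((reorder n t).trans σ) (t := t - 1) (by omega) hM
      ⟨n - t - 1, by omega⟩
    rw [← hpos] at this
    refine this.trans (le_of_eq ?_)
    congr 1
    simp only
    omega
  refine ⟨fun u hu => by rw [hupd, Function.update_of_ne hu], (hw _).1, (hw _).2,
    fun T _ hT => ?_, fun hopt => ?_⟩
  · refine hcost.trans ?_
    have := reachCost_le_cost_update σ (by omega : t < n) hM c hT
    rwa [max_eq_right (by omega)] at this
  · exfalso
    have hle := (hopt _ (hw (σ c)).1 (hw (σ c)).2)
    have hself : Function.update (lasso σ t) (σ c) (lasso ((reorder n t).trans σ) (t - 1) (σ c)) =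
        lasso ((reorder n t).trans σ) (t - 1) := by
      rw [hupd, Function.update_self]
    rw [hself] at hle
    have hold := reachCost_le_cost_update_of_closed σ (t := t) hM (lassoNext t c) c
      (a := t) (b := n) (r := c - 1) le_rfl (by omega) (by omega) (by omega)
      (by simp only [lassoNext]; split_ifs <;> omega)
      (fun k _ _ _ => by simp only [lassoNext]; split_ifs <;> omega)
    have hcur : Function.update (lasso σ t) (σ c) {σ (lassoNext t c)} = lasso σ t := by
      rw [Function.update_eq_self_iff]
      simp [lasso, lassoMap]
    rw [hcur] at hold
    have := reachCost_succ_lt (n := n) (M := M) (r := c - 1) hM (by omega)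
    rw [Nat.sub_add_cancel (by omega)] at this
    omega

theorem not_stronglyConnected_lasso (σ : Equiv.Perm (Fin n)) {t : ℕ} (h₀ : 0 < t) (ht : t < n) :
    ¬ StronglyConnected (lasso σ t) := by
  intro h
  obtain ⟨m, hm⟩ := h (σ ⟨t, ht⟩) (σ ⟨0, by omega⟩)
  obtain ⟨i, -, hi⟩ := (connIn_singleton_iff (f := lassoMap σ t) (fun _ => rfl) _ _ _).1 hm
  rw [lassoMap_iterate, σ.apply_eq_iff_eq] at hi
  have hclosed : ∀ i, t ≤ (((lassoNext t)^[i] (⟨t, ht⟩ : Fin n) : Fin n) : ℕ) := by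
    intro i
    induction i with
    | zero => exact le_rfl
    | succ i ih =>
      rw [Function.iterate_succ_apply']
      simp only [lassoNext]
      split_ifs <;> omega
  have := hclosed i
  rw [hi] at this
  simp only at this
  omega

/-- The order in which the nodes act in round `r` of the slow walk. -/
noncomputable def walkOrder (n T : ℕ) : ℕ → Equiv.Perm (Fin n)
  | 0 => 1
  | r + 1 => (reorder n (T - r)).trans (walkOrder n T r)

/-- The wiring in round `r` of the slow walk, after `j` nodes have acted. -/
noncomputable def walkWiring (n T r j : ℕ) : Fin n → Finset (Fin n) :=
  if j ≤ n - (T - r) then lasso (walkOrder n T r) (T - r)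
  else lasso (walkOrder n T (r + 1)) (T - (r + 1))

theorem brStep_walkWiring {T M : ℕ} (hT : 2 * T ≤ n) (hn : 3 ≤ n) (hM : n < M) (r : ℕ)
    (j : Fin n) :
    BRStep 1 M (walkWiring n T r j) (walkOrder n T r j) (walkWiring n T r (j + 1)) := by
  rcases lt_trichotomy (j : ℕ) (n - (T - r)) with h | h | h
  · rw [walkWiring, walkWiring, if_pos (by omega), if_pos (by omega)]
    exact brStep_lasso_self _ (by omega) hn hM j (by omega)
  · rw [walkWiring, walkWiring, if_pos (by omega), if_neg (by omega)]
    exact brStep_lasso_reorder _ (by omega) (by omega) hn hM j h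
  · rw [walkWiring, walkWiring, if_neg (by omega), if_neg (by omega)]
    have hpos : walkOrder n T r j = walkOrder n T (r + 1) ⟨j - (n - (T - r)) - 1, by omega⟩ := by
      rw [walkOrder, Equiv.trans_apply, reorder_apply (by omega) (by omega)]
      congr 1
      apply Fin.ext
      rw [reorderMap_val (by omega) (by omega)]
      split_ifs <;> simp only at * <;> omega
    rw [hpos]
    exact brStep_lasso_self _ (by omega) hn hM _ (by simp only; omega)

theorem walkWiring_last {T : ℕ} (hT : 2 * T ≤ n) (r : ℕ) :
    walkWiring n T r n = walkWiring n T (r + 1) 0 := by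
  rw [walkWiring, walkWiring, if_pos (Nat.zero_le _)]
  split_ifs with h
  · have ht : T - r = 0 := by omega
    have ht' : T - (r + 1) = 0 := by omega
    rw [ht, ht', walkOrder, ht, reorder, dif_neg (by omega)]
    rfl
  · rfl

theorem not_stronglyConnected_walkWiring {T : ℕ} (hT : 2 * T ≤ n) {r : ℕ} (hr : r + 1 < T)
    (j : ℕ) : ¬ StronglyConnected (walkWiring n T r j) := by
  rw [walkWiring]
  split_ifs
  · exact not_stronglyConnected_lasso _ (by omega) (by omega)
  · exact not_stronglyConnected_lasso _ (by omega) (by omega)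

end Lasso

/-- There is a constant `c > 0` such that for infinitely many `n` there exist
an initial wiring for the uniform `(n,1)`-BDNF game and a round-robin
best-response walk (each round consisting of `n` best-response steps in which
each node acts exactly once) that is still not strongly connected after
`c·n²` best-response steps. -/
theorem stmt_13 :
    ∃ c : ℝ, 0 < c ∧
      ∀ N : ℕ, ∃ n : ℕ, N ≤ n ∧ 2 ≤ n ∧
        ∀ M : ℕ, n ^ 2 < M →
          ∃ w : ℕ → (Fin n → Finset (Fin n)), ∃ a : ℕ → Fin n,
            IsWiring 1 (w 0) ∧
            (∀ i : ℕ, BRStep 1 M (w i) (a i) (w (i + 1))) ∧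
            (∀ r : ℕ,
              Function.Injective (fun j : Fin n => a (r * n + (j : ℕ)))) ∧
            (∀ m : ℕ, (m : ℝ) ≤ c * (n : ℝ) ^ 2 →
              ¬ StronglyConnected (w m)) := by
  refine ⟨1 / 8, by norm_num, fun N => ⟨2 * (N + 2), by omega, by omega, fun M hM => ?_⟩⟩
  obtain ⟨T, hT⟩ : ∃ T, T = N + 2 := ⟨_, rfl⟩
  obtain ⟨n, hn⟩ : ∃ n, n = 2 * T := ⟨_, rfl⟩
  rw [← hT, ← hn] at hM ⊢
  have hn₀ : 0 < n := by omega
  have hnM : n < M := (Nat.le_self_pow two_ne_zero n).trans_lt hM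
  refine ⟨fun m => walkWiring n T (m / n) (m % n),
    fun m => walkOrder n T (m / n) ⟨m % n, Nat.mod_lt _ hn₀⟩, ?_, fun m => ?_, fun r => ?_,
    fun m hm => ?_⟩
  · simp only [Nat.zero_div, Nat.zero_mod, walkWiring, if_pos (Nat.zero_le _)]
    exact isWiring_lasso _ (by omega)
  · have h := brStep_walkWiring (T := T) (by omega) (by omega) hnM (m / n)
      ⟨m % n, Nat.mod_lt _ hn₀⟩
    suffices hw : walkWiring n T ((m + 1) / n) ((m + 1) % n) =
        walkWiring n T (m / n) (m % n + 1) by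
      simpa only [hw] using h
    have hlt := Nat.mod_lt m hn₀
    have hdiv : m + 1 = m % n + 1 + n * (m / n) := by
      have := Nat.mod_add_div m n
      omega
    rcases Nat.lt_or_ge (m % n + 1) n with hlt' | hge
    · rw [hdiv, Nat.add_mul_div_left _ _ hn₀, Nat.add_mul_mod_self_left, Nat.div_eq_of_lt hlt',
        Nat.mod_eq_of_lt hlt', Nat.zero_add]
    · have heq : m % n + 1 = n := by omega
      rw [hdiv, heq, Nat.add_mul_div_left _ _ hn₀, Nat.add_mul_mod_self_left, Nat.div_self hn₀,
        Nat.mod_self, walkWiring_last (by omega), Nat.add_comm 1]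
  · intro a b hab
    have hd : ∀ a : Fin n, (r * n + a) / n = r := fun a => by
      rw [Nat.add_comm, Nat.add_mul_div_right _ _ hn₀, Nat.div_eq_of_lt a.2, Nat.zero_add]
    have hm : ∀ a : Fin n, (r * n + a) % n = a := fun a => by
      rw [Nat.add_comm, Nat.add_mul_mod_self_right, Nat.mod_eq_of_lt a.2]
    simpa only [hd, hm, Fin.eta, EmbeddingLike.apply_eq_iff_eq] using hab
  · refine not_stronglyConnected_walkWiring (by omega) ?_ _
    have hm' : 8 * m ≤ n * n := by
      have : (8 * m : ℝ) ≤ n * n := by nlinarith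
      exact_mod_cast this
    have hmul : n * (m / n) ≤ m := Nat.mul_div_le m n
    have : 8 * (m / n) ≤ n := by
      refine Nat.le_of_mul_le_mul_left ?_ hn₀
      calc n * (8 * (m / n)) = 8 * (n * (m / n)) := by ring
        _ ≤ n * n := by omega
    omega

end BDNF
end
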